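/- There exists a bounded linear operator S on ℓ²(X) such that S e_x = (ℒ(1)(x))^{-1/2} Σ_{y ∈ T⁻¹({x})} e_y for every x ∈ X, and any such operator S is an isometry, i.e. S*S = 1 (equivalently ‖Sξ‖ = ‖ξ‖ for all ξ ∈ ℓ²(X)). -/

import Mathlib

open Classical

noncomputable section

/-- `ℓ²(X)`: the Hilbert space of square-summable complex families indexed by `X`. -/
abbrev l2 (X : Type*) : Type _ := lp (fun _ : X => ℂ) 2

/-- The orthonormal basis vector `e_x` of `ℓ²(X)`. -/
def e {X : Type*} (x : X) : l2 X := lp.single 2 x 1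

end

theorem aux_fin {X : Type*} [TopologicalSpace X] [CompactSpace X] [T2Space X]
    (T : X → X) (hT : IsCoveringMap T) (x : X) : (T ⁻¹' {x}).Finite := by
  have hd : DiscreteTopology (T ⁻¹' {x}) := (hT x).discreteTopology_fiber
  have hc : IsClosed (T ⁻¹' {x}) := isClosed_singleton.preimage hT.continuous
  exact hc.isCompact.finite ⟨hd⟩

theorem aux_ortho {X : Type*} : Orthonormal ℂ (e : X → l2 X) := by
  rw [orthonormal_iff_ite]
  intro i j
  unfold e
  rw [lp.inner_single_left]
  rw [lp.single_apply, Pi.single_apply]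
  split_ifs <;> simp

theorem aux_v {X : Type*} (T : X → X) (hfin : ∀ x, (T ⁻¹' {x}).Finite)
    (hs : Function.Surjective T) :
    Orthonormal ℂ (fun x : X => (((Real.sqrt (Nat.card (T ⁻¹' {x})))⁻¹ : ℝ) : ℂ) •
          ∑ᶠ y ∈ T ⁻¹' {x}, (e y : l2 X)) := by
  rw [orthonormal_iff_ite]
  intro i j
  beta_reduce
  rw [finsum_mem_eq_finite_toFinset_sum _ (hfin i), finsum_mem_eq_finite_toFinset_sum _ (hfin j),
    inner_smul_left, inner_smul_right, sum_inner]
  simp only [inner_sum, orthonormal_iff_ite.mp aux_ortho]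
  split_ifs with hij
  · subst hij
    have hn : 0 < Nat.card (T ⁻¹' {i}) := by
      have := (hfin i).to_subtype
      obtain ⟨y, hy⟩ := hs i
      have : Nonempty (T ⁻¹' {i}) := ⟨⟨y, hy⟩⟩
      exact Nat.card_pos
    have hcard : (hfin i).toFinset.card = Nat.card (T ⁻¹' {i}) :=
      (Nat.card_eq_card_finite_toFinset (hfin i)).symm
    have : ∀ y ∈ (hfin i).toFinset, (∑ z ∈ (hfin i).toFinset, if y = z then (1 : ℂ) else 0) = 1 := by
      intro y hy
      rw [Finset.sum_ite_eq, if_pos hy]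
    rw [Finset.sum_congr rfl this, Finset.sum_const, hcard, Complex.conj_ofReal]
    generalize Nat.card (T ⁻¹' {i}) = n at hn
    have hr : (Real.sqrt n)⁻¹ * ((Real.sqrt n)⁻¹ * (n : ℝ)) = 1 := by
      have h0 : (0 : ℝ) < n := by exact_mod_cast hn
      have h1 := Real.mul_self_sqrt h0.le
      have h2 := (Real.sqrt_pos.mpr h0).ne'
      field_simp
      nlinarith
    rw [nsmul_eq_mul, mul_one]
    exact_mod_cast hr
  · rw [Finset.sum_eq_zero, mul_zero, mul_zero]
    intro y hy
    apply Finset.sum_eq_zero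
    intro z hz
    rw [if_neg]
    rintro rfl
    simp at hy hz
    exact hij (hy.symm.trans hz)

open ContinuousLinearMap in
/-- Let `X` be a compact Hausdorff space and `T : X → X` a covering map.
There exists a bounded operator `S` on `ℓ²(X)` such that
`S e_x = (ℒ(1)(x))^{-1/2} ∑_{y ∈ T⁻¹({x})} e_y` for every `x`, where
`ℒ(1)(x) = card (T⁻¹({x}))`; and any such operator is an isometry: `S*S = 1`,
equivalently `‖Sξ‖ = ‖ξ‖` for all `ξ`. -/
theorem exists_isometry_S {X : Type*} [TopologicalSpace X] [CompactSpace X] [T2Space X]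
    (T : X → X) (hT : IsCoveringMap T) (hTsurj : Function.Surjective T) :
    (∃ S : l2 X →L[ℂ] l2 X, ∀ x : X,
        S (e x) = (((Real.sqrt (Nat.card (T ⁻¹' {x})))⁻¹ : ℝ) : ℂ) •
          ∑ᶠ y ∈ T ⁻¹' {x}, e y) ∧
    ∀ S : l2 X →L[ℂ] l2 X,
      (∀ x : X, S (e x) = (((Real.sqrt (Nat.card (T ⁻¹' {x})))⁻¹ : ℝ) : ℂ) •
          ∑ᶠ y ∈ T ⁻¹' {x}, e y) →
      (adjoint S) ∘L S = 1 ∧ ∀ ξ : l2 X, ‖S ξ‖ = ‖ξ‖ := by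
  have hv := aux_v T (aux_fin T hT) hTsurj
  have key : ∀ x : X, hv.orthogonalFamily.linearIsometry (e x) =
      (((Real.sqrt (Nat.card (T ⁻¹' {x})))⁻¹ : ℝ) : ℂ) • ∑ᶠ y ∈ T ⁻¹' {x}, (e y : l2 X) := by
    intro x
    unfold e
    rw [OrthogonalFamily.linearIsometry_apply_single]
    simp [LinearIsometry.toSpanSingleton_apply, e]
  refine ⟨⟨hv.orthogonalFamily.linearIsometry.toContinuousLinearMap, key⟩, ?_⟩
  intro S hS
  have hSe : ∀ ξ : l2 X, S ξ = hv.orthogonalFamily.linearIsometry ξ := by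
    intro ξ
    have h0 := lp.hasSum_single (E := fun _ : X => ℂ) (p := 2) (by simp) ξ
    have h1 := h0.mapL S
    have h2 := h0.mapL hv.orthogonalFamily.linearIsometry.toContinuousLinearMap
    refine h1.unique ?_
    change HasSum _ (hv.orthogonalFamily.linearIsometry.toContinuousLinearMap ξ)
    convert h2 using 2 with x
    have : (lp.single 2 x (ξ x) : l2 X) = ξ x • e x := by
      unfold e
      rw [← lp.single_smul, smul_eq_mul, mul_one]
    rw [this, map_smul, map_smul, hS]
    exact congrArg _ (key x).symm
  have hn : ∀ ξ : l2 X, ‖S ξ‖ = ‖ξ‖ := by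
    intro ξ
    rw [hSe, LinearIsometry.norm_map]
  exact ⟨(ContinuousLinearMap.norm_map_iff_adjoint_comp_self S).mp hn, hn⟩
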